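/- Let n ≥ 2 be an integer, let Ω ⊆ ℝⁿ be a nonempty bounded open set, let U ⊆ ℝⁿ be an open set containing the closure of Ω, and let f : U → ℝ be a C² function with f(x) > 0 for all x ∈ Ω, f(x) = 0 for all x in the boundary of Ω, and −Δf(x) ≤ C f(x) for all x ∈ Ω, for some constant C ∈ ℝ. Then λ*(Ω) ≤ C. -/

import Mathlib

open scoped ENNReal Topology
open MeasureTheory

/-- The fundamental tone `λ*(Ω)` of an open set `Ω ⊆ ℝⁿ`: the infimum of the Rayleigh
quotients `∫_Ω ‖∇φ‖² / ∫_Ω φ²` over all smooth functions `φ : ℝⁿ → ℝ`, not identically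
zero, with compact support contained in `Ω` (valued in `ℝ≥0∞`; it is `∞` if no such `φ`
exists). -/
noncomputable def lamStar (n : ℕ) (Ω : Set (EuclideanSpace ℝ (Fin n))) : ℝ≥0∞ :=
  ⨅ φ : {φ : EuclideanSpace ℝ (Fin n) → ℝ //
      ContDiff ℝ (⊤ : ℕ∞) φ ∧ HasCompactSupport φ ∧ tsupport φ ⊆ Ω ∧ φ ≠ 0},
    ENNReal.ofReal ((∫ x in Ω, ‖gradient φ.1 x‖ ^ 2) / ∫ x in Ω, φ.1 x ^ 2)

/-- The divergence of a vector field `X : ℝⁿ → ℝⁿ` at `x`: the trace of its derivative. -/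
noncomputable def ediv {n : ℕ} (X : EuclideanSpace ℝ (Fin n) → EuclideanSpace ℝ (Fin n))
    (x : EuclideanSpace ℝ (Fin n)) : ℝ :=
  LinearMap.trace ℝ _ (fderiv ℝ X x).toLinearMap

/-- The Laplacian of `f : ℝⁿ → ℝ` at `x`: the trace of its Hessian, i.e. the divergence
of its gradient. -/
noncomputable def lap {n : ℕ} (f : EuclideanSpace ℝ (Fin n) → ℝ)
    (x : EuclideanSpace ℝ (Fin n)) : ℝ :=
  LinearMap.trace ℝ _ (fderiv ℝ (gradient f) x).toLinearMap

theorem exists_contDiff_approx_fderiv {n : ℕ} {Ω : Set (EuclideanSpace ℝ (Fin n))}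
    (hΩ : IsOpen Ω) {g : EuclideanSpace ℝ (Fin n) → ℝ} (hg : ContDiff ℝ 1 g)
    (hgc : HasCompactSupport g) (hgΩ : tsupport g ⊆ Ω) {δ : ℝ} (hδ : 0 < δ) :
    ∃ φ : EuclideanSpace ℝ (Fin n) → ℝ, ContDiff ℝ (⊤ : ℕ∞) φ ∧ HasCompactSupport φ ∧
      tsupport φ ⊆ Ω ∧ (∀ x, ‖φ x - g x‖ ≤ δ) ∧ ∀ x, ‖gradient φ x - gradient g x‖ ≤ δ := by
  obtain ⟨r₀, hr₀, hrΩ⟩ := hgc.isCompact.exists_cthickening_subset_open hΩ hgΩ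
  have hg' : Continuous (fderiv ℝ g) := hg.continuous_fderiv one_ne_zero
  obtain ⟨r₁, hr₁, h₁⟩ := Metric.uniformContinuous_iff.1
    (hgc.uniformContinuous_of_continuous hg.continuous) δ hδ
  obtain ⟨r₂, hr₂, h₂⟩ := Metric.uniformContinuous_iff.1
    ((hgc.fderiv ℝ).uniformContinuous_of_continuous hg') δ hδ
  set r := min r₀ (min r₁ r₂)
  have hr : 0 < r := lt_min hr₀ (lt_min hr₁ hr₂)
  let b : ContDiffBump (0 : EuclideanSpace ℝ (Fin n)) := ⟨r / 2, r, by positivity, by linarith⟩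
  have hbl : LocallyIntegrable (b.normed volume) volume :=
    b.continuous_normed.locallyIntegrable
  have hfd : ∀ x, fderiv ℝ
      (convolution (b.normed volume) g (ContinuousLinearMap.lsmul ℝ ℝ) volume) x =
      convolution (b.normed volume) (fderiv ℝ g) (ContinuousLinearMap.lsmul ℝ ℝ) volume x := by
    intro x
    rw [(hgc.hasFDerivAt_convolution_right (ContinuousLinearMap.lsmul ℝ ℝ) hbl hg x).fderiv]
    rfl
  have hsupp : tsupport (convolution (b.normed volume) g (ContinuousLinearMap.lsmul ℝ ℝ) volume) ⊆
      Metric.cthickening r₀ (tsupport g) := by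
    refine closure_minimal ?_ Metric.isClosed_cthickening
    refine (support_convolution_subset _).trans ?_
    rw [b.support_normed_eq]
    rintro _ ⟨u, hu, v, hv, rfl⟩
    refine Metric.mem_cthickening_of_dist_le _ v _ _ (subset_tsupport _ hv) ?_
    have : ‖u‖ < r := by simpa [b] using hu
    simpa using (this.trans_le (min_le_left _ _)).le
  refine ⟨convolution (b.normed volume) g (ContinuousLinearMap.lsmul ℝ ℝ) volume,
    b.hasCompactSupport_normed.contDiff_convolution_left _ b.contDiff_normed
      hg.continuous.locallyIntegrable, b.hasCompactSupport_normed.convolution _ hgc,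
      hsupp.trans hrΩ, fun x ↦ ?_, fun x ↦ ?_⟩
  · rw [← dist_eq_norm]
    refine b.dist_normed_convolution_le hg.continuous.aestronglyMeasurable fun y hy ↦ (h₁ ?_).le
    exact (Metric.mem_ball.1 hy).trans_le ((min_le_right _ _).trans (min_le_left _ _))
  · rw [gradient, gradient, ← map_sub, LinearIsometryEquiv.norm_map, hfd, ← dist_eq_norm]
    refine b.dist_normed_convolution_le hg'.aestronglyMeasurable fun y hy ↦ (h₂ ?_).le
    exact (Metric.mem_ball.1 hy).trans_le ((min_le_right _ _).trans (min_le_right _ _))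

theorem ContDiff.continuous_gradient {n : ℕ} {g : EuclideanSpace ℝ (Fin n) → ℝ}
    (hg : ContDiff ℝ 1 g) : Continuous (gradient g) :=
  (LinearIsometryEquiv.continuous _).comp (hg.continuous_fderiv one_ne_zero)

theorem tendsto_setIntegral_norm_sq {n : ℕ} {F : Type*} [NormedAddCommGroup F]
    {Ω : Set (EuclideanSpace ℝ (Fin n))}
    (hΩ : IsOpen Ω) (hΩb : Bornology.IsBounded Ω) {u : EuclideanSpace ℝ (Fin n) → F}
    {v : ℕ → EuclideanSpace ℝ (Fin n) → F} (hu : Continuous u) (hv : ∀ k, Continuous (v k))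
    (huv : ∀ k x, ‖v k x - u x‖ ≤ 1 / ((k : ℝ) + 1)) :
    Filter.Tendsto (fun k ↦ ∫ x in Ω, ‖v k x‖ ^ 2) Filter.atTop (𝓝 (∫ x in Ω, ‖u x‖ ^ 2)) := by
  obtain ⟨M, hM⟩ := hΩb.isCompact_closure.exists_bound_of_continuousOn hu.continuousOn
  have hfin : IsFiniteMeasure (volume.restrict Ω) := ⟨by simpa using hΩb.measure_lt_top⟩
  refine tendsto_integral_of_dominated_convergence (fun _ ↦ (M + 1) ^ 2)
    (fun k ↦ ((hv k).norm.pow 2).aestronglyMeasurable) (integrable_const _) (fun k ↦ ?_)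
    (.of_forall fun x ↦ ?_)
  · filter_upwards [ae_restrict_mem hΩ.measurableSet] with x hx
    have h1 : ‖v k x‖ ≤ ‖u x‖ + ‖v k x - u x‖ := by
      simpa using norm_add_le (u x) (v k x - u x)
    have h2 : 1 / ((k : ℝ) + 1) ≤ 1 := by
      rw [div_le_one (by positivity)]; linarith [Nat.cast_nonneg (α := ℝ) k]
    have h3 := hM x (subset_closure hx)
    rw [Real.norm_of_nonneg (by positivity)]
    gcongr
    linarith [huv k x]
  · refine (Filter.Tendsto.norm ?_).pow 2
    exact tendsto_iff_norm_sub_tendsto_zero.2 (squeeze_zero (fun k ↦ norm_nonneg _)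
      (fun k ↦ huv k x) tendsto_one_div_add_atTop_nhds_zero_nat)

theorem lamStar_le_of_contDiff_one {n : ℕ} {Ω : Set (EuclideanSpace ℝ (Fin n))}
    (hΩ : IsOpen Ω) (hΩb : Bornology.IsBounded Ω) {g : EuclideanSpace ℝ (Fin n) → ℝ}
    (hg : ContDiff ℝ 1 g) (hgc : HasCompactSupport g) (hgΩ : tsupport g ⊆ Ω)
    (hpos : 0 < ∫ x in Ω, g x ^ 2) :
    lamStar n Ω ≤ ENNReal.ofReal ((∫ x in Ω, ‖gradient g x‖ ^ 2) / ∫ x in Ω, g x ^ 2) := by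
  choose φ hφ hφc hφΩ hφg hφg' using fun k : ℕ ↦ exists_contDiff_approx_fderiv hΩ hg hgc hgΩ
    (show (0 : ℝ) < 1 / ((k : ℝ) + 1) by positivity)
  have h1 := tendsto_setIntegral_norm_sq hΩ hΩb hg.continuous (fun k ↦ (hφ k).continuous) hφg
  have h2 := tendsto_setIntegral_norm_sq hΩ hΩb hg.continuous_gradient
    (fun k ↦ ((hφ k).of_le (by exact_mod_cast le_top)).continuous_gradient) hφg'
  simp only [Real.norm_eq_abs, sq_abs] at h1
  refine ge_of_tendsto (ENNReal.tendsto_ofReal (h2.div h1 hpos.ne')) ?_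
  filter_upwards [h1.eventually_const_lt hpos] with k hk
  refine iInf_le_of_le ⟨φ k, hφ k, hφc k, hφΩ k, ?_⟩ le_rfl
  intro h
  simp [h] at hk

theorem contDiff_one_of_eq_zero_of_notMem_compact {E F : Type*} [NormedAddCommGroup E]
    [NormedSpace ℝ E] [NormedAddCommGroup F] [NormedSpace ℝ F] {Ω K : Set E} {h : E → F}
    (hΩ : IsOpen Ω) (hK : IsCompact K) (hKΩ : K ⊆ Ω) (hh : ContDiffOn ℝ 1 h Ω)
    (h0 : ∀ x ∉ K, h x = 0) :
    ContDiff ℝ 1 h ∧ HasCompactSupport h ∧ tsupport h ⊆ Ω := by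
  have hts : tsupport h ⊆ K :=
    closure_minimal (fun x hx ↦ by_contra fun hxK ↦ hx (h0 x hxK)) hK.isClosed
  refine ⟨contDiff_iff_contDiffAt.2 fun x ↦ ?_, HasCompactSupport.intro hK h0, hts.trans hKΩ⟩
  by_cases hx : x ∈ Ω
  · exact hh.contDiffAt (hΩ.mem_nhds hx)
  · refine (contDiffAt_const (c := (0 : F))).congr_of_eventuallyEq ?_
    filter_upwards [hK.isClosed.isOpen_compl.mem_nhds fun hxK ↦ hx (hKΩ hxK)] with y hy
    exact h0 y hy

theorem ediv_eq_sum {n : ℕ} (X : EuclideanSpace ℝ (Fin n) → EuclideanSpace ℝ (Fin n))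
    (x : EuclideanSpace ℝ (Fin n)) :
    ediv X x = ∑ i, fderiv ℝ X x (EuclideanSpace.basisFun (Fin n) ℝ i) i := by
  rw [ediv, LinearMap.trace_eq_sum_inner _ (EuclideanSpace.basisFun (Fin n) ℝ)]
  simp [EuclideanSpace.inner_single_left]

theorem continuous_ediv {n : ℕ} {X : EuclideanSpace ℝ (Fin n) → EuclideanSpace ℝ (Fin n)}
    (hX : ContDiff ℝ 1 X) : Continuous (ediv X) := by
  have hX' := hX.continuous_fderiv one_ne_zero
  rw [funext (ediv_eq_sum X)]
  fun_prop

theorem integral_ediv_eq_zero {n : ℕ} {X : EuclideanSpace ℝ (Fin n) → EuclideanSpace ℝ (Fin n)}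
    (hX : ContDiff ℝ 1 X) (hXc : HasCompactSupport X) : ∫ x, ediv X x = 0 := by
  have hX' := hX.continuous_fderiv one_ne_zero
  have hint : ∀ v, Integrable (fun x ↦ fderiv ℝ X x v) := fun v ↦
    (by fun_prop : Continuous fun x ↦ fderiv ℝ X x v).integrable_of_hasCompactSupport
      (hXc.fderiv_apply ℝ v)
  have hzero : ∀ v, ∫ x, fderiv ℝ X x v = 0 := fun v ↦ by
    simpa using integral_smul_fderiv_eq_neg_fderiv_smul_of_integrable (𝕜 := ℝ) (μ := volume)
      (f := fun _ ↦ 1) (g := X) (v := v) (by simp) (by simpa using hint v)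
      (by simpa using hX.continuous.integrable_of_hasCompactSupport hXc)
      (fun _ _ ↦ by fun_prop) (fun x _ ↦ hX.differentiable one_ne_zero x)
  simp only [ediv_eq_sum]
  rw [integral_finsetSum _ fun i _ ↦ ?_]
  · refine Finset.sum_eq_zero fun i _ ↦ ?_
    have := (EuclideanSpace.proj (𝕜 := ℝ) i).integral_comp_comm
      (hint (EuclideanSpace.basisFun (Fin n) ℝ i))
    rw [hzero] at this
    simpa using this
  · exact (EuclideanSpace.proj (𝕜 := ℝ) i).integrable_comp
      (hint (EuclideanSpace.basisFun (Fin n) ℝ i))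

theorem ediv_smul {n : ℕ} {g : EuclideanSpace ℝ (Fin n) → ℝ}
    {V : EuclideanSpace ℝ (Fin n) → EuclideanSpace ℝ (Fin n)} {x : EuclideanSpace ℝ (Fin n)}
    (hg : DifferentiableAt ℝ g x) (hV : DifferentiableAt ℝ V x) :
    ediv (fun y ↦ g y • V y) x = g x * ediv V x + fderiv ℝ g x (V x) := by
  rw [ediv_eq_sum, fderiv_fun_smul hg hV, ediv_eq_sum]
  have : fderiv ℝ g x (V x) =
      ∑ i, fderiv ℝ g x (EuclideanSpace.basisFun (Fin n) ℝ i) * V x i := by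
    conv_lhs => rw [← (EuclideanSpace.basisFun (Fin n) ℝ).sum_repr (V x)]
    simp [mul_comm]
  rw [this, Finset.mul_sum, ← Finset.sum_add_distrib]
  simp

open Set in
theorem exists_hasDerivAt_truncation {ε : ℝ} (hε : 0 < ε) :
    ∃ η θ : ℝ → ℝ, Continuous θ ∧ (∀ t, HasDerivAt η (θ t) t) ∧ (∀ t, 0 ≤ θ t ∧ θ t ≤ 1) ∧
      (∀ t ≤ ε, η t = 0) ∧ (∀ t, 0 ≤ η t) ∧ (∀ t, t - 2 * ε ≤ η t) ∧ ∀ t, 0 ≤ t → η t ≤ t := by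
  set θ : ℝ → ℝ := fun t ↦ max 0 (min 1 ((t - ε) / ε)) with hθdef
  have hθ : Continuous θ := by fun_prop
  have h0 : ∀ t, 0 ≤ θ t := fun t ↦ le_max_left _ _
  have h1 : ∀ t, θ t ≤ 1 := fun t ↦ max_le zero_le_one (min_le_left _ _)
  have hlow : ∀ t ≤ ε, θ t = 0 := fun t ht ↦
    max_eq_left ((min_le_right _ _).trans (div_nonpos_of_nonpos_of_nonneg (by linarith) hε.le))
  have hhigh : ∀ t, 2 * ε ≤ t → θ t = 1 := fun t ht ↦ by
    have : 1 ≤ (t - ε) / ε := by rw [le_div_iff₀ hε]; linarith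
    simp [hθdef, min_eq_left this]
  have hi : ∀ a b, IntervalIntegrable θ volume a b := hθ.intervalIntegrable
  have hz : ∀ t ≤ ε, ∫ s in ε..t, θ s = 0 := fun t ht ↦ by
    rw [intervalIntegral.integral_congr (g := fun _ ↦ 0)]
    · simp
    · intro s hs
      rw [uIcc_of_ge ht] at hs
      exact hlow s hs.2
  have hnn : ∀ t, 0 ≤ ∫ s in ε..t, θ s := fun t ↦ by
    rcases le_total t ε with ht | ht
    · exact (hz t ht).ge
    · exact intervalIntegral.integral_nonneg ht fun s _ ↦ h0 s
  refine ⟨fun t ↦ ∫ s in ε..t, θ s, θ, hθ, fun t ↦ ?_, fun t ↦ ⟨h0 t, h1 t⟩, hz, hnn,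
    fun t ↦ ?_, fun t ht ↦ ?_⟩
  · exact intervalIntegral.integral_hasDerivAt_right (hi _ _)
      (hθ.stronglyMeasurableAtFilter _ _) hθ.continuousAt
  · rcases le_total t (2 * ε) with ht | ht
    · linarith [hnn t]
    · beta_reduce
      rw [← intervalIntegral.integral_add_adjacent_intervals (hi ε (2 * ε)) (hi _ _)]
      have : ∫ s in (2 * ε)..t, θ s = t - 2 * ε := by
        rw [intervalIntegral.integral_congr (g := fun _ ↦ 1)]
        · simp
        · intro s hs
          rw [uIcc_of_le ht] at hs
          exact hhigh s hs.1
      linarith [hnn (2 * ε)]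
  · rcases le_total t ε with ht' | ht'
    · exact (hz t ht').trans_le ht
    · have := intervalIntegral.integral_mono_on ht' (hi _ _)
        (continuous_const (y := (1 : ℝ)).intervalIntegrable _ _) fun s _ ↦ h1 s
      simp at this
      linarith

/-- The quotient bound obtained by testing with a `C¹` truncation of `f` at height `ε`. -/
theorem lamStar_le_truncation {n : ℕ} {Ω U : Set (EuclideanSpace ℝ (Fin n))} (hΩ : IsOpen Ω)
    (hΩb : Bornology.IsBounded Ω) (hU : IsOpen U) (hΩU : closure Ω ⊆ U)
    {f : EuclideanSpace ℝ (Fin n) → ℝ} (hf : ContDiffOn ℝ 2 f U)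
    (hfpos : ∀ x ∈ Ω, 0 < f x) (hfb : ∀ x ∈ frontier Ω, f x = 0)
    {C : ℝ} (hC0 : 0 ≤ C) (hC : ∀ x ∈ Ω, -lap f x ≤ C * f x) {ε : ℝ} (hε : 0 < ε)
    (hlow : 0 < (∫ x in Ω, f x ^ 2) - 4 * ε * ∫ x in Ω, f x) :
    lamStar n Ω ≤ ENNReal.ofReal
      (C * (∫ x in Ω, f x ^ 2) / ((∫ x in Ω, f x ^ 2) - 4 * ε * ∫ x in Ω, f x)) := by
  obtain ⟨η, θ, hθ, hη, hθ01, hηε, hη0, hηl, hηu⟩ := exists_hasDerivAt_truncation hε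
  have hη1 : ContDiff ℝ 1 η := by
    rw [contDiff_one_iff_deriv, funext fun t ↦ (hη t).deriv]
    exact ⟨fun t ↦ (hη t).differentiableAt, hθ⟩
  have hΩU' : Ω ⊆ U := subset_closure.trans hΩU
  have hfcl : ContinuousOn f (closure Ω) := hf.continuousOn.mono hΩU
  set K : Set (EuclideanSpace ℝ (Fin n)) := closure Ω ∩ f ⁻¹' Set.Ici ε
  have hK : IsCompact K := hΩb.isCompact_closure.of_isClosed_subset
    (hfcl.preimage_isClosed_of_isClosed isClosed_closure isClosed_Ici) Set.inter_subset_left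
  have hKΩ : K ⊆ Ω := fun x hx ↦ by
    by_contra hxΩ
    have h0 := hfb x ⟨hx.1, by rwa [hΩ.interior_eq]⟩
    have h1 : ε ≤ f x := hx.2
    linarith
  set g : EuclideanSpace ℝ (Fin n) → ℝ := Ω.indicator fun x ↦ η (f x)
  have hgΩ : ∀ x ∈ Ω, g x = η (f x) := fun x hx ↦ Set.indicator_of_mem hx _
  have hgK : ∀ x ∉ K, g x = 0 := fun x hx ↦ by
    by_cases hxΩ : x ∈ Ω
    · rw [hgΩ x hxΩ]
      exact hηε _ (not_le.1 fun h ↦ hx ⟨subset_closure hxΩ, h⟩).le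
    · exact Set.indicator_of_notMem hxΩ _
  have hg1 : ContDiffOn ℝ 1 g Ω :=
    (hη1.comp_contDiffOn ((hf.mono hΩU').of_le one_le_two)).congr hgΩ
  have hgrad : ContDiffOn ℝ 1 (gradient f) Ω :=
    (LinearIsometryEquiv.contDiff _).comp_contDiffOn
      ((hf.fderiv_of_isOpen hU (by norm_num)).mono hΩU')
  obtain ⟨hg, hgc, hgs⟩ := contDiff_one_of_eq_zero_of_notMem_compact hΩ hK hKΩ hg1 hgK
  obtain ⟨hX, hXc, hXs⟩ := contDiff_one_of_eq_zero_of_notMem_compact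
    (h := fun x ↦ g x • gradient f x) hΩ hK hKΩ (hg1.smul hgrad) fun x hx ↦ by simp [hgK x hx]
  have hfΩ : ∀ x ∈ Ω, DifferentiableAt ℝ f x := fun x hx ↦
    (hf.contDiffAt (hU.mem_nhds (hΩU' hx))).differentiableAt two_ne_zero
  have hgrad_g : ∀ x ∈ Ω, HasGradientAt g (θ (f x) • gradient f x) x := fun x hx ↦ by
    have h1 := (hη (f x)).comp_hasFDerivAt x (hfΩ x hx).hasFDerivAt
    have h2 : g =ᶠ[𝓝 x] η ∘ f := by
      filter_upwards [hΩ.mem_nhds hx] with y hy using hgΩ y hy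
    rw [hasGradientAt_iff_hasFDerivAt, map_smul, toDual_gradient]
    exact h1.congr_of_eventuallyEq h2
  have hpt : ∀ x ∈ Ω, ‖gradient g x‖ ^ 2 ≤
      ediv (fun y ↦ g y • gradient f y) x + C * f x ^ 2 := fun x hx ↦ by
    rw [ediv_smul (hg.differentiable one_ne_zero x)
      ((hgrad.contDiffAt (hΩ.mem_nhds hx)).differentiableAt one_ne_zero),
      (hgrad_g x hx).gradient, (hgrad_g x hx).fderiv_apply, inner_smul_left,
      real_inner_self_eq_norm_sq, norm_smul, mul_pow, hgΩ x hx, Real.norm_eq_abs, sq_abs]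
    have h1 : -ediv (gradient f) x ≤ C * f x := hC x hx
    have h2 := mul_le_mul_of_nonneg_left h1 (hη0 (f x))
    have h3 := mul_le_mul_of_nonneg_right (hηu (f x) (hfpos x hx).le)
      (mul_nonneg hC0 (hfpos x hx).le)
    have h4 : θ (f x) ^ 2 ≤ θ (f x) := by nlinarith [(hθ01 (f x)).1, (hθ01 (f x)).2]
    have h5 := mul_le_mul_of_nonneg_right h4 (sq_nonneg ‖gradient f x‖)
    simp only [conj_trivial]
    nlinarith
  have hint : ∀ {u : EuclideanSpace ℝ (Fin n) → ℝ}, ContinuousOn u (closure Ω) →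
      IntegrableOn u Ω := fun hu ↦
    (hu.integrableOn_compact hΩb.isCompact_closure).mono_set subset_closure
  have hf2 : IntegrableOn (fun x ↦ f x ^ 2) Ω := hint (hfcl.pow 2)
  have hdiv : ∫ x in Ω, ediv (fun y ↦ g y • gradient f y) x = 0 := by
    rw [setIntegral_eq_integral_of_forall_compl_eq_zero, integral_ediv_eq_zero hX hXc]
    intro x hx
    simp [ediv, fderiv_of_notMem_tsupport ℝ fun h ↦ hx (hXs h)]
  have hnum : ∫ x in Ω, ‖gradient g x‖ ^ 2 ≤ C * ∫ x in Ω, f x ^ 2 := by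
    have hd := hint (continuous_ediv hX).continuousOn
    refine (setIntegral_mono_on (hint (hg.continuous_gradient.norm.pow 2).continuousOn)
      (hd.add (hf2.const_mul C)) hΩ.measurableSet hpt).trans_eq ?_
    rw [← integral_const_mul]
    exact (integral_add hd (hf2.const_mul C)).trans (by rw [hdiv, zero_add])
  have hden : (∫ x in Ω, f x ^ 2) - 4 * ε * ∫ x in Ω, f x ≤ ∫ x in Ω, g x ^ 2 := by
    have hf1 := (hint hfcl).const_mul (4 * ε)
    rw [← integral_const_mul, ← integral_sub hf2 hf1]
    refine setIntegral_mono_on (hf2.sub hf1) (hint (hg.continuous.pow 2).continuousOn)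
      hΩ.measurableSet fun x hx ↦ ?_
    rw [hgΩ x hx]
    have h0 := hfpos x hx
    have h1 := hηl (f x)
    have h2 := hη0 (f x)
    rcases le_total (f x) (2 * ε) with h | h
    · nlinarith [sq_nonneg (η (f x))]
    · nlinarith
  refine (lamStar_le_of_contDiff_one hΩ hΩb hg hgc hgs (hlow.trans_le hden)).trans ?_
  refine ENNReal.ofReal_le_ofReal (div_le_div₀ ?_ hnum hlow hden)
  exact mul_nonneg hC0 (integral_nonneg fun x ↦ sq_nonneg _)

/-- upper-bound half of Barta's Theorem 2.1, Euclidean case: if `Ω ⊆ ℝⁿ` is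
a nonempty bounded open set, `f` is `C²` on an open neighbourhood `U` of the closure of
`Ω`, positive in `Ω`, vanishes on the boundary of `Ω`, and `-Δf ≤ C f` on `Ω`, then
`λ*(Ω) ≤ C`. -/
theorem stmt3 (n : ℕ) (hn : 2 ≤ n) (Ω : Set (EuclideanSpace ℝ (Fin n))) (hΩ : IsOpen Ω)
    (hΩne : Ω.Nonempty) (hΩb : Bornology.IsBounded Ω)
    (U : Set (EuclideanSpace ℝ (Fin n))) (hU : IsOpen U) (hΩU : closure Ω ⊆ U)
    (f : EuclideanSpace ℝ (Fin n) → ℝ) (hf : ContDiffOn ℝ 2 f U)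
    (hfpos : ∀ x ∈ Ω, 0 < f x) (hfb : ∀ x ∈ frontier Ω, f x = 0)
    (C : ℝ) (hC : ∀ x ∈ Ω, -lap f x ≤ C * f x) :
    lamStar n Ω ≤ ENNReal.ofReal C := by
  wlog hC0 : 0 ≤ C generalizing C
  · rw [ENNReal.ofReal_of_nonpos (not_le.1 hC0).le, ← ENNReal.ofReal_zero]
    refine this 0 (fun x hx ↦ (hC x hx).trans ?_) le_rfl
    exact mul_le_mul_of_nonneg_right (not_le.1 hC0).le (hfpos x hx).le
  have hpos : 0 < ∫ x in Ω, f x ^ 2 := by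
    have hfc : ContinuousOn (fun x ↦ f x ^ 2) (closure Ω) := (hf.continuousOn.mono hΩU).pow 2
    rw [setIntegral_pos_iff_support_of_nonneg_ae (.of_forall fun x ↦ sq_nonneg _)
      ((hfc.integrableOn_compact hΩb.isCompact_closure).mono_set subset_closure)]
    rw [Set.inter_eq_right.2 fun x hx ↦ Function.mem_support.2 (pow_pos (hfpos x hx) 2).ne']
    exact hΩ.measure_pos volume hΩne
  set A := ∫ x in Ω, f x ^ 2
  set B := ∫ x in Ω, f x
  have hden : Filter.Tendsto (fun ε : ℝ ↦ A - 4 * ε * B) (𝓝[>] 0) (𝓝 A) := by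
    have : Continuous fun ε : ℝ ↦ A - 4 * ε * B := by fun_prop
    simpa using (this.tendsto 0).mono_left nhdsWithin_le_nhds
  have hquot : Filter.Tendsto (fun ε : ℝ ↦ ENNReal.ofReal (C * A / (A - 4 * ε * B))) (𝓝[>] 0)
      (𝓝 (ENNReal.ofReal C)) := by
    have := ENNReal.tendsto_ofReal ((tendsto_const_nhds (x := C * A)).div hden hpos.ne')
    rwa [mul_div_cancel_right₀ C hpos.ne'] at this
  refine ge_of_tendsto hquot ?_
  filter_upwards [hden.eventually_const_lt hpos, self_mem_nhdsWithin] with ε hlow hε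
  exact lamStar_le_truncation hΩ hΩb hU hΩU hf hfpos hfb hC0 hC hε hlow
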